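/- Let μ be a Borel probability measure on (0,∞) with ∫₀^∞ v^{-3/2} μ(dv) < ∞, let φ(x) = ∫₀^∞ ρ_v(x) μ(dv), g = φ'/φ, and h(x) = (d²/dx²) log φ(x) − (1/x)(d/dx) log φ(x) for x ≠ 0. Then h·φ and g²·φ are Lebesgue-integrable on ℝ and ∫_ℝ h(x) φ(x) dx = ∫₀^∞ v^{-1} μ(dv) − ∫_ℝ g(x)² φ(x) dx. -/

import Mathlib

open MeasureTheory
open scoped ENNReal

/-- The density `ρ_v(x) = (2πv)^{-1/2} exp(−x²/(2v))` of the centered Gaussian law `N(0,v)`. -/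
noncomputable def gaussDens (v x : ℝ) : ℝ :=
  Real.exp (-(x ^ 2) / (2 * v)) / Real.sqrt (2 * Real.pi * v)

/-- The normal variance-mixture function `φ(x) = ∫₀^∞ ρ_v(x) μ(dv)`. -/
noncomputable def mixDens (μ : Measure ℝ) (x : ℝ) : ℝ :=
  ∫ v, gaussDens v x ∂μ

/-- `g(x) = φ'(x)/φ(x)`. -/
noncomputable def gFun (μ : Measure ℝ) (x : ℝ) : ℝ :=
  deriv (mixDens μ) x / mixDens μ x

/-- `h(x) = (log φ)''(x) − (1/x)(log φ)'(x)`. -/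
noncomputable def hFun (μ : Measure ℝ) (x : ℝ) : ℝ :=
  deriv (deriv (fun y => Real.log (mixDens μ y))) x
    - (1 / x) * deriv (fun y => Real.log (mixDens μ y)) x

lemma gaussDens_nonneg (v x : ℝ) : 0 ≤ gaussDens v x := by
  unfold gaussDens; positivity

lemma gaussDens_pos {v : ℝ} (hv : 0 < v) (x : ℝ) : 0 < gaussDens v x := by
  unfold gaussDens; positivity

lemma measurable_uncurry_gaussDens : Measurable (Function.uncurry gaussDens) := by
  unfold gaussDens Function.uncurry
  fun_prop

lemma measurable_gaussDens_left (x : ℝ) : Measurable fun v => gaussDens v x :=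
  measurable_uncurry_gaussDens.comp (measurable_id.prodMk measurable_const)

lemma inv_mul_inv_sqrt {v : ℝ} (hv : 0 < v) : v⁻¹ * (Real.sqrt v)⁻¹ = v ^ (-(3 / 2) : ℝ) := by
  rw [Real.sqrt_eq_rpow, ← Real.rpow_neg hv.le, ← Real.rpow_neg_one, ← Real.rpow_add hv]
  norm_num

lemma gaussDens_le_exp_mul {v : ℝ} (hv : 0 < v) (x : ℝ) :
    gaussDens v x ≤ Real.exp (-(x ^ 2) / (2 * v)) * (Real.sqrt v)⁻¹ := by
  unfold gaussDens
  rw [div_eq_mul_inv]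
  have : Real.sqrt v ≤ Real.sqrt (2 * Real.pi * v) :=
    Real.sqrt_le_sqrt (by nlinarith [Real.pi_gt_three])
  have := Real.sqrt_pos.2 hv
  gcongr

lemma gaussDens_le_inv_sqrt {v : ℝ} (hv : 0 < v) (x : ℝ) :
    gaussDens v x ≤ (Real.sqrt v)⁻¹ := by
  refine (gaussDens_le_exp_mul hv x).trans (mul_le_of_le_one_left (by positivity) ?_)
  rw [Real.exp_le_one_iff, neg_div]
  have : 0 ≤ x ^ 2 / (2 * v) := by positivity
  linarith

lemma inv_mul_gaussDens_le {v : ℝ} (hv : 0 < v) (x : ℝ) :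
    v⁻¹ * gaussDens v x ≤ v ^ (-(3 / 2) : ℝ) := by
  rw [← inv_mul_inv_sqrt hv]
  have := gaussDens_le_inv_sqrt hv x
  gcongr

lemma sq_div_mul_gaussDens_le {v : ℝ} (hv : 0 < v) (x : ℝ) :
    x ^ 2 / v ^ 2 * gaussDens v x ≤ 2 * v ^ (-(3 / 2) : ℝ) := by
  rw [← inv_mul_inv_sqrt hv]
  have h1 := gaussDens_le_exp_mul hv x
  have h2 : x ^ 2 / v * Real.exp (-(x ^ 2) / (2 * v)) ≤ 2 := by
    have e : -(x ^ 2) / (2 * v) = -(x ^ 2 / v / 2) := by field_simp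
    rw [e, Real.exp_neg, ← div_eq_mul_inv, div_le_iff₀ (Real.exp_pos _)]
    linarith [Real.add_one_le_exp (x ^ 2 / v / 2)]
  have h3 : 0 ≤ v⁻¹ * (Real.sqrt v)⁻¹ := by positivity
  calc x ^ 2 / v ^ 2 * gaussDens v x
      ≤ x ^ 2 / v ^ 2 * (Real.exp (-(x ^ 2) / (2 * v)) * (Real.sqrt v)⁻¹) := by gcongr
    _ = x ^ 2 / v * Real.exp (-(x ^ 2) / (2 * v)) * (v⁻¹ * (Real.sqrt v)⁻¹) := by
        field_simp
    _ ≤ 2 * (v⁻¹ * (Real.sqrt v)⁻¹) := by gcongr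

lemma hasDerivAt_gaussDens {v : ℝ} (hv : 0 < v) (x : ℝ) :
    HasDerivAt (gaussDens v) (-(x / v) * gaussDens v x) x := by
  have h : HasDerivAt (fun x : ℝ => -(x ^ 2) / (2 * v)) (-(x / v)) x := by
    refine (((hasDerivAt_id x).pow 2).neg.div_const (2 * v)).congr_deriv ?_
    simp
    field_simp
  refine (h.exp.div_const (Real.sqrt (2 * Real.pi * v))).congr_deriv ?_
  unfold gaussDens
  ring

lemma hasDerivAt_neg_div_mul_gaussDens {v : ℝ} (hv : 0 < v) (x : ℝ) :
    HasDerivAt (fun x => -(x / v) * gaussDens v x)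
      (x ^ 2 / v ^ 2 * gaussDens v x - v⁻¹ * gaussDens v x) x := by
  refine (((hasDerivAt_id x).div_const v).neg.mul (hasDerivAt_gaussDens hv x)).congr_deriv ?_
  simp
  ring

lemma gaussDens_eq_gaussianPDFReal {v : ℝ} (hv : 0 < v) (x : ℝ) :
    gaussDens v x = ProbabilityTheory.gaussianPDFReal 0 v.toNNReal x := by
  rw [gaussDens, ProbabilityTheory.gaussianPDFReal, Real.coe_toNNReal v hv.le, sub_zero,
    div_eq_mul_inv, mul_comm]

lemma integral_sq_mul_gaussDens {v : ℝ} (hv : 0 < v) : ∫ x, x ^ 2 * gaussDens v x = v := by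
  have hne : v.toNNReal ≠ 0 := (Real.toNNReal_pos.2 hv).ne'
  have h := ProbabilityTheory.variance_id_gaussianReal (μ := 0) (v := v.toNNReal)
  rw [ProbabilityTheory.variance_eq_integral measurable_id.aemeasurable] at h
  simp only [id, ProbabilityTheory.integral_id_gaussianReal, sub_zero] at h
  rw [ProbabilityTheory.integral_gaussianReal_eq_integral_smul hne] at h
  simpa [gaussDens_eq_gaussianPDFReal hv, hv.le, mul_comm] using h

lemma integral_sq_div_mul_gaussDens {v : ℝ} (hv : 0 < v) :
    ∫ x, x ^ 2 / v ^ 2 * gaussDens v x = v⁻¹ := by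
  have : ∀ x, x ^ 2 / v ^ 2 * gaussDens v x = (v ^ 2)⁻¹ * (x ^ 2 * gaussDens v x) := by
    intro x; ring
  simp_rw [this, integral_const_mul, integral_sq_mul_gaussDens hv]
  field_simp

lemma integrable_sq_div_mul_gaussDens {v : ℝ} (hv : 0 < v) :
    Integrable fun x => x ^ 2 / v ^ 2 * gaussDens v x :=
  .of_integral_ne_zero <| by rw [integral_sq_div_mul_gaussDens hv]; positivity

section Mixture

variable {μ : Measure ℝ}

lemma ae_pos_of_measure_Iic_zero (hμ : μ (Set.Iic 0) = 0) : ∀ᵐ v ∂μ, 0 < v := by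
  filter_upwards [measure_eq_zero_iff_ae_notMem.1 hμ] with v hv
  simpa using hv

lemma integrable_rpow_of_lintegral_lt_top (hμ : ∀ᵐ v ∂μ, 0 < v)
    (hmom : ∫⁻ v, ENNReal.ofReal (v ^ (-(3 / 2) : ℝ)) ∂μ < ⊤) :
    Integrable (fun v : ℝ => v ^ (-(3 / 2) : ℝ)) μ := by
  refine ⟨by fun_prop, ?_⟩
  rw [hasFiniteIntegral_iff_ofReal]
  · exact hmom
  · filter_upwards [hμ] with v hv
    positivity

variable (hμ : ∀ᵐ v ∂μ, 0 < v) (hint : Integrable (fun v : ℝ => v ^ (-(3 / 2) : ℝ)) μ)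

include hμ hint

lemma integrable_inv_mul_gaussDens (x : ℝ) : Integrable (fun v => v⁻¹ * gaussDens v x) μ := by
  refine hint.mono' (measurable_inv.mul (measurable_gaussDens_left x)).aestronglyMeasurable ?_
  filter_upwards [hμ] with v hv
  rw [Real.norm_of_nonneg (mul_nonneg (by positivity) (gaussDens_nonneg v x))]
  exact inv_mul_gaussDens_le hv x

lemma integrable_sq_div_mul_gaussDens_left (x : ℝ) :
    Integrable (fun v => x ^ 2 / v ^ 2 * gaussDens v x) μ := by
  refine (hint.const_mul 2).mono'
    ((by fun_prop : Measurable fun v : ℝ => x ^ 2 / v ^ 2).mul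
      (measurable_gaussDens_left x)).aestronglyMeasurable ?_
  filter_upwards [hμ] with v hv
  rw [Real.norm_of_nonneg (mul_nonneg (by positivity) (gaussDens_nonneg v x))]
  exact sq_div_mul_gaussDens_le hv x

lemma integrable_neg_div_mul_gaussDens (x : ℝ) :
    Integrable (fun v => -(x / v) * gaussDens v x) μ := by
  refine ((integrable_inv_mul_gaussDens hμ hint x).const_mul (-x)).congr (.of_forall fun v => ?_)
  simp only
  ring

lemma hasDerivAt_integral_neg_div_mul_gaussDens (x : ℝ) :
    HasDerivAt (fun x => ∫ v, -(x / v) * gaussDens v x ∂μ)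
      ((∫ v, x ^ 2 / v ^ 2 * gaussDens v x ∂μ) - ∫ v, v⁻¹ * gaussDens v x ∂μ) x := by
  rw [← integral_sub (integrable_sq_div_mul_gaussDens_left hμ hint x)
    (integrable_inv_mul_gaussDens hμ hint x)]
  refine (hasDerivAt_integral_of_dominated_loc_of_deriv_le
    (F := fun x v => -(x / v) * gaussDens v x)
    (F' := fun x v => x ^ 2 / v ^ 2 * gaussDens v x - v⁻¹ * gaussDens v x)
    (bound := fun v => 3 * v ^ (-(3 / 2) : ℝ)) (Metric.ball_mem_nhds x one_pos)
    (.of_forall fun y => (integrable_neg_div_mul_gaussDens hμ hint y).aestronglyMeasurable)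
    (integrable_neg_div_mul_gaussDens hμ hint x)
    ((integrable_sq_div_mul_gaussDens_left hμ hint x).sub
      (integrable_inv_mul_gaussDens hμ hint x)).aestronglyMeasurable ?_
    (hint.const_mul _) ?_).2
  · filter_upwards [hμ] with v hv y _
    have h1 := sq_div_mul_gaussDens_le hv y
    have h2 := inv_mul_gaussDens_le hv y
    have h3 : 0 ≤ y ^ 2 / v ^ 2 * gaussDens v y :=
      mul_nonneg (by positivity) (gaussDens_nonneg v y)
    have h4 : 0 ≤ v⁻¹ * gaussDens v y := mul_nonneg (by positivity) (gaussDens_nonneg v y)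
    rw [Real.norm_eq_abs, abs_le]
    constructor <;> linarith
  · filter_upwards [hμ] with v hv y _
    exact hasDerivAt_neg_div_mul_gaussDens hv y

variable [IsProbabilityMeasure μ]

lemma integrable_inv_of_integrable_rpow : Integrable (fun v : ℝ => v⁻¹) μ := by
  refine ((integrable_const (1 : ℝ)).add hint).mono' (by fun_prop) ?_
  filter_upwards [hμ] with v hv
  rw [Real.norm_of_nonneg (by positivity), Pi.add_apply, ← Real.rpow_neg_one]
  rcases le_total 1 v with h | h
  · have := Real.rpow_le_one_of_one_le_of_nonpos h (z := -1) (by norm_num)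
    have := Real.rpow_nonneg hv.le (-(3 / 2))
    linarith
  · have := Real.rpow_le_rpow_of_exponent_ge hv h (show (-(3 / 2) : ℝ) ≤ -1 by norm_num)
    linarith

lemma integrable_gaussDens_left (x : ℝ) : Integrable (fun v => gaussDens v x) μ := by
  refine ((integrable_const (1 : ℝ)).add hint).mono'
    (measurable_gaussDens_left x).aestronglyMeasurable ?_
  filter_upwards [hμ] with v hv
  rw [Real.norm_of_nonneg (gaussDens_nonneg v x), Pi.add_apply]
  refine (gaussDens_le_inv_sqrt hv x).trans ?_
  rw [Real.sqrt_eq_rpow, ← Real.rpow_neg hv.le]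
  rcases le_total 1 v with h | h
  · have := Real.rpow_le_one_of_one_le_of_nonpos h (z := -(1 / 2)) (by norm_num)
    have := Real.rpow_nonneg hv.le (-(3 / 2))
    linarith
  · have := Real.rpow_le_rpow_of_exponent_ge hv h
      (show (-(3 / 2) : ℝ) ≤ -(1 / 2) by norm_num)
    linarith

lemma mixDens_pos (x : ℝ) : 0 < mixDens μ x := by
  rw [mixDens, integral_pos_iff_support_of_nonneg (fun v => gaussDens_nonneg v x)
    (integrable_gaussDens_left hμ hint x), pos_iff_ne_zero]
  intro h
  have h0 : ∀ᵐ v ∂μ, False := by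
    filter_upwards [hμ, measure_eq_zero_iff_ae_notMem.1 h] with v hv hv'
    exact hv' (gaussDens_pos hv x).ne'
  exact IsProbabilityMeasure.ne_zero μ (by simpa using h0)

lemma hasDerivAt_mixDens (x : ℝ) :
    HasDerivAt (mixDens μ) (∫ v, -(x / v) * gaussDens v x ∂μ) x := by
  refine (hasDerivAt_integral_of_dominated_loc_of_deriv_le
    (F := fun x v => gaussDens v x) (F' := fun x v => -(x / v) * gaussDens v x)
    (bound := fun v => (|x| + 1) * v ^ (-(3 / 2) : ℝ)) (Metric.ball_mem_nhds x one_pos)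
    (.of_forall fun y => (measurable_gaussDens_left y).aestronglyMeasurable)
    (integrable_gaussDens_left hμ hint x)
    (integrable_neg_div_mul_gaussDens hμ hint x).aestronglyMeasurable ?_
    (hint.const_mul _) ?_).2
  · filter_upwards [hμ] with v hv y hy
    have e : -(y / v) * gaussDens v y = -(y * (v⁻¹ * gaussDens v y)) := by ring
    rw [e, norm_neg, norm_mul,
      Real.norm_of_nonneg (mul_nonneg (inv_nonneg.2 hv.le) (gaussDens_nonneg v y))]
    have hy1 : ‖y‖ ≤ |x| + 1 := by
      rw [Metric.mem_ball, Real.dist_eq] at hy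
      have := abs_sub_abs_le_abs_sub y x
      rw [Real.norm_eq_abs]
      linarith
    exact mul_le_mul hy1 (inv_mul_gaussDens_le hv y)
      (mul_nonneg (inv_nonneg.2 hv.le) (gaussDens_nonneg v y)) (by positivity)
  · filter_upwards [hμ] with v hv y _
    exact hasDerivAt_gaussDens hv y

lemma deriv_mixDens : deriv (mixDens μ) = fun x => ∫ v, -(x / v) * gaussDens v x ∂μ :=
  funext fun x => (hasDerivAt_mixDens hμ hint x).deriv

lemma deriv_log_mixDens : deriv (fun y => Real.log (mixDens μ y)) = gFun μ :=
  funext fun x => by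
    rw [((hasDerivAt_mixDens hμ hint x).log (mixDens_pos hμ hint x).ne').deriv, gFun,
      deriv_mixDens hμ hint]

lemma hFun_mul_mixDens {x : ℝ} (hx : x ≠ 0) :
    hFun μ x * mixDens μ x =
      (∫ v, x ^ 2 / v ^ 2 * gaussDens v x ∂μ) - gFun μ x ^ 2 * mixDens μ x := by
  have hpos := mixDens_pos hμ hint x
  have hB : ∫ v, -(x / v) * gaussDens v x ∂μ = -x * ∫ v, v⁻¹ * gaussDens v x ∂μ := by
    rw [← integral_const_mul]
    congr 1 with v
    ring
  have hg := (hasDerivAt_integral_neg_div_mul_gaussDens hμ hint x).div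
    (hasDerivAt_mixDens hμ hint x) hpos.ne'
  have hgF : gFun μ = (fun x => ∫ v, -(x / v) * gaussDens v x ∂μ) / mixDens μ := by
    ext y
    rw [gFun, deriv_mixDens hμ hint, Pi.div_apply]
  rw [hFun, deriv_log_mixDens hμ hint, hgF, hg.deriv]
  simp only [Pi.div_apply, hB]
  field_simp
  ring

lemma gFun_sq_mul_mixDens_le (x : ℝ) :
    gFun μ x ^ 2 * mixDens μ x ≤ ∫ v, x ^ 2 / v ^ 2 * gaussDens v x ∂μ := by
  have hpos := mixDens_pos hμ hint x
  have hA := integrable_sq_div_mul_gaussDens_left hμ hint x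
  have hB := integrable_neg_div_mul_gaussDens hμ hint x
  have hC := integrable_gaussDens_left hμ hint x
  have hg : gFun μ x * mixDens μ x = ∫ v, -(x / v) * gaussDens v x ∂μ := by
    rw [gFun, deriv_mixDens hμ hint, div_mul_cancel₀ _ hpos.ne']
  have h0 : 0 ≤ ∫ v, (-(x / v) - gFun μ x) ^ 2 * gaussDens v x ∂μ :=
    integral_nonneg fun v => mul_nonneg (sq_nonneg _) (gaussDens_nonneg v x)
  have h1 : ∫ v, (-(x / v) - gFun μ x) ^ 2 * gaussDens v x ∂μ =
      (∫ v, x ^ 2 / v ^ 2 * gaussDens v x ∂μ)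
        - 2 * gFun μ x * (∫ v, -(x / v) * gaussDens v x ∂μ) + gFun μ x ^ 2 * mixDens μ x := by
    rw [mixDens, ← integral_const_mul, ← integral_const_mul,
      ← integral_sub hA (hB.const_mul _)]
    refine Eq.trans ?_ (integral_add (hA.sub (hB.const_mul _)) (hC.const_mul _))
    congr 1 with v
    ring
  rw [h1, ← hg] at h0
  linarith

lemma integrable_prod_sq_div_mul_gaussDens :
    Integrable (Function.uncurry fun v x : ℝ => x ^ 2 / v ^ 2 * gaussDens v x)
      (μ.prod volume) := by
  have hm : Measurable (Function.uncurry fun v x : ℝ => x ^ 2 / v ^ 2 * gaussDens v x) :=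
    (by fun_prop : Measurable fun p : ℝ × ℝ => p.2 ^ 2 / p.1 ^ 2).mul
      measurable_uncurry_gaussDens
  rw [integrable_prod_iff hm.aestronglyMeasurable]
  constructor
  · filter_upwards [hμ] with v hv using integrable_sq_div_mul_gaussDens hv
  · refine (integrable_inv_of_integrable_rpow hμ hint).congr ?_
    filter_upwards [hμ] with v hv
    rw [← integral_sq_div_mul_gaussDens hv]
    congr 1 with x
    exact (Real.norm_of_nonneg (mul_nonneg (by positivity) (gaussDens_nonneg v x))).symm

lemma integrable_gFun_sq_mul_mixDens : Integrable fun x => gFun μ x ^ 2 * mixDens μ x := by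
  have hφ : Continuous (mixDens μ) :=
    continuous_iff_continuousAt.2 fun x => (hasDerivAt_mixDens hμ hint x).continuousAt
  refine (integrable_prod_sq_div_mul_gaussDens hμ hint).integral_prod_right.mono'
    ((((measurable_deriv _).div hφ.measurable).pow_const 2).mul
      hφ.measurable).aestronglyMeasurable (.of_forall fun x => ?_)
  rw [Real.norm_of_nonneg (mul_nonneg (sq_nonneg _) (mixDens_pos hμ hint x).le)]
  exact gFun_sq_mul_mixDens_le hμ hint x

lemma integral_integral_sq_div_mul_gaussDens :
    ∫ x, ∫ v, x ^ 2 / v ^ 2 * gaussDens v x ∂μ = ∫ v, v⁻¹ ∂μ := by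
  rw [← integral_integral_swap (integrable_prod_sq_div_mul_gaussDens hμ hint)]
  refine integral_congr_ae ?_
  filter_upwards [hμ] with v hv using integral_sq_div_mul_gaussDens hv

end Mixture

/-- If `μ` is a Borel probability measure on `(0,∞)` with
`∫ v^{-3/2} μ(dv) < ∞`, then `h·φ` and `g²·φ` are Lebesgue-integrable on `ℝ` and
`∫ h(x) φ(x) dx = ∫ v⁻¹ μ(dv) − ∫ g(x)² φ(x) dx`. -/
theorem hFun_integral_identity (μ : Measure ℝ) [IsProbabilityMeasure μ]
    (hμ : μ (Set.Iic 0) = 0)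
    (hmom : ∫⁻ v, ENNReal.ofReal (v ^ (-(3 / 2) : ℝ)) ∂μ < ⊤) :
    Integrable (fun x => hFun μ x * mixDens μ x) volume ∧
    Integrable (fun x => gFun μ x ^ 2 * mixDens μ x) volume ∧
    (∫ x : ℝ, hFun μ x * mixDens μ x)
      = (∫ v, v⁻¹ ∂μ) - ∫ x : ℝ, gFun μ x ^ 2 * mixDens μ x := by
  have hpos := ae_pos_of_measure_Iic_zero hμ
  have hint := integrable_rpow_of_lintegral_lt_top hpos hmom
  have hg := integrable_gFun_sq_mul_mixDens hpos hint
  have hA := (integrable_prod_sq_div_mul_gaussDens hpos hint).integral_prod_right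
  have hae : (fun x => hFun μ x * mixDens μ x) =ᵐ[volume]
      fun x => (∫ v, x ^ 2 / v ^ 2 * gaussDens v x ∂μ) - gFun μ x ^ 2 * mixDens μ x := by
    filter_upwards [Measure.ae_ne volume 0] with x hx using hFun_mul_mixDens hpos hint hx
  refine ⟨(hA.sub hg).congr hae.symm, hg, ?_⟩
  rw [integral_congr_ae hae, ← integral_integral_sq_div_mul_gaussDens hpos hint]
  exact integral_sub hA hg
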